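/- arXiv:2203.04943 — 7 statements merged into one kernel-verified Lean document; each statement's English description precedes it below -/
import Mathlib

section
/- Let T : ℂ → ℂ, α ∈ ℝ and C ≥ 1 be such that |T(w) − e^{2πiα}·w| ≤ C|w|² for every w in the closed unit ball of ℂ. Let 0 < r < R be real numbers with C·R ≤ 1 and R + C·r ≤ 1, and let N ∈ ℕ satisfy: (a) 5^N · R² ≤ r; and (b) for every β ∈ ℝ there exist n ∈ ℕ with n ≤ N and k ∈ ℤ such that |n·α − β − k| ≤ r/R. Let S be a subset of the closed unit ball of ℂ with T(S) ⊆ S, and suppose that for every ρ ∈ [0, R] there exists z ∈ S with |z| = ρ. Then for every y ∈ ℂ with |y| ≤ R there exists w ∈ S with |w − y| ≤ (2π + C)·r. -/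
open Complex in
theorem norm_exp_ofReal_mul_I_sub_one_le (x : ℝ) : ‖exp (x * I) - 1‖ ≤ |x| := by
  simpa [mul_comm] using Real.norm_exp_I_mul_ofReal_sub_one_le (x := x)

theorem iterate_mem_of_image_subset {X : Type*} {T : X → X} {S : Set X} (hTS : T '' S ⊆ S)
    {z : X} (hz : z ∈ S) (n : ℕ) : T^[n] z ∈ S :=
  (Set.mapsTo_iff_image_subset.mpr hTS).iterate n hz

open Complex in
theorem norm_rotation_pow_mul_sub_le {α δ : ℝ} {y z : ℂ} (hzy : ‖z‖ = ‖y‖) {n : ℕ} (k : ℤ)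
    (hk : |(n : ℝ) * α - (y.arg - z.arg) / (2 * Real.pi) - k| ≤ δ) :
    ‖exp (((2 * Real.pi * α : ℝ) : ℂ) * I) ^ n * z - y‖ ≤ 2 * Real.pi * δ * ‖y‖ := by
  set t : ℝ := n * α - (y.arg - z.arg) / (2 * Real.pi) - k with ht
  have hangle : n * (2 * Real.pi * α) + z.arg = 2 * Real.pi * t + y.arg + k * (2 * Real.pi) := by
    rw [ht]
    field_simp [Real.pi_ne_zero]
    ring
  have hexp : exp (((2 * Real.pi * α : ℝ) : ℂ) * I) ^ n * exp (z.arg * I) =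
      exp ((2 * Real.pi * t : ℝ) * I) * exp (y.arg * I) := by
    rw [← exp_nat_mul, ← exp_add, ← exp_add]
    refine exp_eq_exp_iff_exists_int.mpr ⟨k, ?_⟩
    have := congrArg (fun x : ℝ => (x : ℂ) * I) hangle
    push_cast at this ⊢
    linear_combination this
  have heq : exp (((2 * Real.pi * α : ℝ) : ℂ) * I) ^ n * z - y =
      (exp ((2 * Real.pi * t : ℝ) * I) - 1) * y := by
    have hz := norm_mul_exp_arg_mul_I z
    have hy := norm_mul_exp_arg_mul_I y
    rw [hzy] at hz
    linear_combination (‖y‖ : ℂ) * hexp -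
      exp (((2 * Real.pi * α : ℝ) : ℂ) * I) ^ n * hz + exp ((2 * Real.pi * t : ℝ) * I) * hy
  rw [heq, norm_mul]
  gcongr
  refine (norm_exp_ofReal_mul_I_sub_one_le _).trans ?_
  rw [abs_mul, abs_of_pos Real.two_pi_pos]
  gcongr

/-- As long as the accumulated error stays below `‖z‖`, the orbit of `z` stays in the ball of
radius `2 * ‖z‖`, so that each step costs at most a factor `5` in the error bound. -/
theorem norm_iterate_sub_rotation_le {T : ℂ → ℂ} {l : ℂ} (hl : ‖l‖ = 1) {C r : ℝ} (hC : 0 ≤ C)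
    {S : Set ℂ} (hT : ∀ w ∈ S, ‖T w - l * w‖ ≤ C * ‖w‖ ^ 2) (hTS : T '' S ⊆ S)
    {z : ℂ} (hz : z ∈ S) (hCr : C * r ≤ ‖z‖) {N : ℕ} (hN : 5 ^ N * ‖z‖ ^ 2 ≤ r)
    {n : ℕ} (hn : n ≤ N) : ‖T^[n] z - l ^ n * z‖ ≤ C * 5 ^ n * ‖z‖ ^ 2 := by
  induction n with
  | zero => simpa using by positivity
  | succ n ih =>
    specialize ih (by omega)
    have herr : C * 5 ^ n * ‖z‖ ^ 2 ≤ ‖z‖ := by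
      refine le_trans ?_ hCr
      rw [mul_assoc]
      refine mul_le_mul_of_nonneg_left (le_trans ?_ hN) hC
      gcongr
      · norm_num
      · omega
    have hnorm : ‖T^[n] z‖ ≤ 2 * ‖z‖ := by
      have := norm_le_norm_sub_add (T^[n] z) (l ^ n * z)
      rw [norm_mul, norm_pow, hl, one_pow, one_mul] at this
      linarith
    have hstep := hT _ (iterate_mem_of_image_subset hTS hz n)
    have hsq : C * ‖T^[n] z‖ ^ 2 ≤ C * (2 * ‖z‖) ^ 2 := by gcongr
    have hone : C * ‖z‖ ^ 2 ≤ C * 5 ^ n * ‖z‖ ^ 2 := by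
      gcongr
      exact le_mul_of_one_le_right hC (one_le_pow₀ (by norm_num))
    rw [Function.iterate_succ_apply']
    calc ‖T (T^[n] z) - l ^ (n + 1) * z‖
        = ‖(T (T^[n] z) - l * T^[n] z) + l * (T^[n] z - l ^ n * z)‖ := by
          congr 1
          ring
      _ ≤ ‖T (T^[n] z) - l * T^[n] z‖ + ‖T^[n] z - l ^ n * z‖ := by
          refine (norm_add_le _ _).trans_eq ?_
          rw [norm_mul l, hl, one_mul]
      _ ≤ C * 5 ^ (n + 1) * ‖z‖ ^ 2 := by
          rw [pow_succ]
          linarith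

/-- Core density step in the Cremer case: under the quantitative hypotheses on
`T` near the Cremer fixed point `0`, a forward-invariant set `S` (the Julia
set) meeting every circle of radius `≤ R` about `0` is `(2π + C)r`-dense in
the ball `B(0,R)`. -/
theorem cremer_density_step (T : ℂ → ℂ) (α C : ℝ) (hC : 1 ≤ C)
    (hT : ∀ w : ℂ, ‖w‖ ≤ 1 →
      ‖T w - Complex.exp (((2 * Real.pi * α : ℝ) : ℂ) * Complex.I) * w‖ ≤ C * ‖w‖ ^ 2)
    (r R : ℝ) (hr : 0 < r) (hrR : r < R) (hCR : C * R ≤ 1) (hRCr : R + C * r ≤ 1)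
    (N : ℕ) (hN : 5 ^ N * R ^ 2 ≤ r)
    (hdense : ∀ β : ℝ, ∃ n : ℕ, n ≤ N ∧ ∃ k : ℤ, |(n : ℝ) * α - β - (k : ℝ)| ≤ r / R)
    (S : Set ℂ) (hS : S ⊆ Metric.closedBall 0 1) (hTS : T '' S ⊆ S)
    (hcircle : ∀ ρ : ℝ, ρ ∈ Set.Icc (0 : ℝ) R → ∃ z ∈ S, ‖z‖ = ρ) :
    ∀ y : ℂ, ‖y‖ ≤ R → ∃ w ∈ S, ‖w - y‖ ≤ (2 * Real.pi + C) * r := by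
  intro y hy
  by_cases hsmall : ‖y‖ ≤ (2 * Real.pi + C) * r
  · obtain ⟨z, hz, hz0⟩ := hcircle 0 ⟨le_rfl, by linarith⟩
    refine ⟨z, hz, ?_⟩
    simpa [norm_eq_zero.mp hz0] using hsmall
  have hCr : C * r ≤ ‖y‖ := by
    nlinarith [mul_pos Real.pi_pos hr]
  obtain ⟨z, hz, hzy⟩ := hcircle ‖y‖ ⟨norm_nonneg y, hy⟩
  obtain ⟨n, hn, k, hk⟩ := hdense ((y.arg - z.arg) / (2 * Real.pi))
  refine ⟨T^[n] z, iterate_mem_of_image_subset hTS hz n, ?_⟩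
  have hpow : 5 ^ N * ‖z‖ ^ 2 ≤ r := by
    refine le_trans ?_ hN
    rw [hzy]
    gcongr
  have hclose := norm_iterate_sub_rotation_le (Complex.norm_exp_ofReal_mul_I _) (by linarith)
    (fun w hw => hT w (by simpa using hS hw)) hTS hz (hzy ▸ hCr) hpow hn
  have hrot := norm_rotation_pow_mul_sub_le hzy k hk
  have hyR : 2 * Real.pi * (r / R) * ‖y‖ ≤ 2 * Real.pi * r := by
    calc 2 * Real.pi * (r / R) * ‖y‖ ≤ 2 * Real.pi * (r / R) * R := by
          have := hr.trans hrR
          have := Real.pi_pos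
          gcongr
      _ = 2 * Real.pi * r := by
          have := (hr.trans hrR).ne'
          field_simp
  have herr : C * 5 ^ n * ‖z‖ ^ 2 ≤ C * r := by
    rw [mul_assoc]
    refine mul_le_mul_of_nonneg_left (le_trans ?_ hpow) (by linarith)
    gcongr
    norm_num
  linarith [norm_sub_le_norm_sub_add_norm_sub (T^[n] z)
    (Complex.exp (((2 * Real.pi * α : ℝ) : ℂ) * Complex.I) ^ n * z) y]
end

section
/- Let E ⊆ ℂ, x ∈ ℂ, c ≥ 1 and r > 0, R > 0 with R ≥ 8(c+2)·r. Suppose that every point of the closed ball B(x,R) lies within distance c·r of some point of E. Then every finite family of closed balls of radius r whose union covers E ∩ B(x, 2R) has cardinality at least (R/(8(c+2)r))². -/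
theorem Complex.sq_radius_le_card_mul_of_closedBall_subset {x : ℂ} {R ρ : ℝ} (hR : 0 ≤ R)
    (hρ : 0 ≤ ρ) {s : Finset ℂ}
    (h : Metric.closedBall x R ⊆ ⋃ b ∈ s, Metric.closedBall b ρ) :
    R ^ 2 ≤ s.card * ρ ^ 2 := by
  have hball (z : ℂ) {t : ℝ} (ht : 0 ≤ t) :
      MeasureTheory.volume.real (Metric.closedBall z t) = t ^ 2 * Real.pi := by
    simp [MeasureTheory.measureReal_def, Complex.volume_closedBall, ht]
  have hfin : MeasureTheory.volume (⋃ b ∈ s, Metric.closedBall b ρ) ≠ ⊤ :=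
    (s.isCompact_biUnion fun b _ => isCompact_closedBall b ρ).measure_lt_top.ne
  have hvol := (MeasureTheory.measureReal_mono h hfin).trans
    (MeasureTheory.measureReal_biUnion_finset_le s _)
  simp only [hball _ hR, hball _ hρ, Finset.sum_const, nsmul_eq_mul, ← mul_assoc] at hvol
  exact le_of_mul_le_mul_right hvol Real.pi_pos

/-- If every point of the closed ball `B(x,R)` lies within distance `c·r` of
the set `E`, and `R ≥ 8(c+2)r`, then any finite family of closed balls of
radius `r` covering `E ∩ B(x,2R)` has cardinality at least `(R/(8(c+2)r))²`. -/
theorem density_implies_covering_lower_bound (E : Set ℂ) (x : ℂ) (c r R : ℝ)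
    (hc : 1 ≤ c) (hr : 0 < r) (hR : 0 < R) (hRr : 8 * (c + 2) * r ≤ R)
    (hdense : ∀ y ∈ Metric.closedBall x R, ∃ e ∈ E, dist y e ≤ c * r) :
    ∀ s : Finset ℂ,
      (E ∩ Metric.closedBall x (2 * R) ⊆ ⋃ b ∈ s, Metric.closedBall b r) →
      (R / (8 * (c + 2) * r)) ^ 2 ≤ (s.card : ℝ) := by
  intro s hs
  have hcr : 0 < c * r := by positivity
  have hcover : Metric.closedBall x R ⊆ ⋃ b ∈ s, Metric.closedBall b ((c + 1) * r) := by
    intro y hy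
    obtain ⟨e, he, hye⟩ := hdense y hy
    rw [Metric.mem_closedBall] at hy
    have hex : e ∈ Metric.closedBall x (2 * R) := by
      rw [Metric.mem_closedBall]
      linarith [dist_triangle_left e x y]
    obtain ⟨b, hb, heb⟩ := Set.mem_iUnion₂.1 (hs ⟨he, hex⟩)
    rw [Metric.mem_closedBall] at heb
    refine Set.mem_iUnion₂.2 ⟨b, hb, ?_⟩
    rw [Metric.mem_closedBall]
    linarith [dist_triangle y e b]
  have hsq := Complex.sq_radius_le_card_mul_of_closedBall_subset hR.le (by positivity) hcover
  rw [div_pow, div_le_iff₀ (by positivity)]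
  refine hsq.trans ?_
  gcongr
  linarith
end

section
/- Let h, p, a, b, r, R be real numbers with h ≥ 1, p ≥ 0, 0 < a ≤ b ≤ R, and 0 < r ≤ b^{p/(1+p)}·a^{1/(1+p)}. Then R^{h} / (r · a^{h−1}) ≤ (R/r)^{h+(h−1)p}. -/
/-- Global measure formula inequality (Case 2, h ≥ 1):
if `0 < a ≤ b ≤ R` and `0 < r ≤ b^{p/(1+p)} a^{1/(1+p)}`, then
`R^h / (r a^{h-1}) ≤ (R/r)^{h+(h-1)p}`. -/
theorem zoom_case2_ineq_h_ge_one (h p a b r R : ℝ) (hh : 1 ≤ h) (hp : 0 ≤ p)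
    (ha : 0 < a) (hab : a ≤ b) (hbR : b ≤ R) (hr : 0 < r)
    (hrn : r ≤ b ^ (p / (1 + p)) * a ^ (1 / (1 + p))) :
    R ^ h / (r * a ^ (h - 1)) ≤ (R / r) ^ (h + (h - 1) * p) := by
  have hb : 0 < b := ha.trans_le hab
  have hR : 0 < R := hb.trans_le hbR
  have hp1 : 0 < 1 + p := by linarith
  have hlogr : (1 + p) * Real.log r ≤ p * Real.log b + Real.log a := by
    have hlog := Real.log_le_log hr hrn
    rw [Real.log_mul (by positivity) (by positivity), Real.log_rpow hb, Real.log_rpow ha] at hlog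
    calc (1 + p) * Real.log r
        ≤ (1 + p) * (p / (1 + p) * Real.log b + 1 / (1 + p) * Real.log a) := by gcongr
      _ = p * Real.log b + Real.log a := by field_simp
  have hlogb : p * Real.log b ≤ p * Real.log R := by gcongr
  rw [← Real.log_le_log_iff (by positivity) (by positivity), Real.log_rpow (by positivity),
    Real.log_div (by positivity) (by positivity), Real.log_div hR.ne' hr.ne',
    Real.log_mul hr.ne' (by positivity), Real.log_rpow hR, Real.log_rpow ha]
  have hgap : 0 ≤ (h - 1) * (p * Real.log R + Real.log a - (1 + p) * Real.log r) :=
    mul_nonneg (by linarith) (by linarith)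
  linarith
end

section
/- Let h, p₁, p₂, a, b', b, r, R be real numbers with h ≥ 1, p₁ ≥ p₂ ≥ 0, 0 < a ≤ b' ≤ b, 0 < r ≤ (b')^{p₂/(1+p₂)}·a^{1/(1+p₂)}, and R > 0. Then R^{h+(h−1)p₁} / (r · b^{(h−1)p₁} · a^{h−1}) ≤ (R/r)^{h+(h−1)p₁}. -/
/-- A weighted geometric mean bound, cleared of its roots. -/
theorem rpow_one_add_le_of_le_geom_mean {p a c r : ℝ} (hp : 0 ≤ p) (ha : 0 < a) (hc : 0 < c)
    (hr : 0 < r) (h : r ≤ c ^ (p / (1 + p)) * a ^ (1 / (1 + p))) :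
    r ^ (1 + p) ≤ c ^ p * a := by
  have hp' : 0 < 1 + p := by linarith
  calc r ^ (1 + p) ≤ (c ^ (p / (1 + p)) * a ^ (1 / (1 + p))) ^ (1 + p) :=
        Real.rpow_le_rpow hr.le h hp'.le
    _ = c ^ p * a := by
        rw [Real.mul_rpow (by positivity) (by positivity), ← Real.rpow_mul hc.le,
          ← Real.rpow_mul ha.le, div_mul_cancel₀ _ hp'.ne', div_mul_cancel₀ _ hp'.ne',
          Real.rpow_one]

/-- The bound `r ^ (1 + p) ≤ c ^ p * a` with `a ≤ c` persists when `p` and `c` increase. -/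
theorem rpow_one_add_le_of_rpow_one_add_le {p q a c b r : ℝ} (hp : 0 ≤ p) (hpq : p ≤ q)
    (ha : 0 < a) (hac : a ≤ c) (hcb : c ≤ b) (hr : 0 < r) (h : r ^ (1 + p) ≤ c ^ p * a) :
    r ^ (1 + q) ≤ b ^ q * a := by
  have hc : 0 < c := ha.trans_le hac
  have hb : 0 < b := hc.trans_le hcb
  have hrc : r ≤ c := by
    refine (Real.rpow_le_rpow_iff hr.le hc.le (by linarith : 0 < 1 + p)).1 (h.trans ?_)
    rw [add_comm, Real.rpow_add_one hc.ne']
    gcongr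
  have hpq' : 0 ≤ q - p := sub_nonneg.2 hpq
  calc r ^ (1 + q) = r ^ (1 + p) * r ^ (q - p) := by
        rw [← Real.rpow_add hr]; ring_nf
    _ ≤ (b ^ p * a) * b ^ (q - p) := by
        have hrb : r ≤ b := hrc.trans hcb
        have h' : r ^ (1 + p) ≤ b ^ p * a := h.trans (by gcongr)
        gcongr
    _ = b ^ q * a := by
        rw [mul_right_comm, ← Real.rpow_add hb, add_sub_cancel]

/-- Global measure formula inequality (Case 3, h ≥ 1, p₁ ≥ p₂):
if `0 < a ≤ b' ≤ b`, `0 < r ≤ (b')^{p₂/(1+p₂)} a^{1/(1+p₂)}` and `R > 0`, then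
`R^{h+(h-1)p₁} / (r b^{(h-1)p₁} a^{h-1}) ≤ (R/r)^{h+(h-1)p₁}`. -/
theorem zoom_case3_ineq_h_ge_one_p1_ge_p2 (h p₁ p₂ a b' b r R : ℝ)
    (hh : 1 ≤ h) (hp₂ : 0 ≤ p₂) (hp : p₂ ≤ p₁)
    (ha : 0 < a) (hab' : a ≤ b') (hb'b : b' ≤ b) (hr : 0 < r)
    (hrn : r ≤ b' ^ (p₂ / (1 + p₂)) * a ^ (1 / (1 + p₂))) (hR : 0 < R) :
    R ^ (h + (h - 1) * p₁) / (r * b ^ ((h - 1) * p₁) * a ^ (h - 1))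
      ≤ (R / r) ^ (h + (h - 1) * p₁) := by
  have hb : 0 < b := ha.trans_le (hab'.trans hb'b)
  have key : r ^ (1 + p₁) ≤ b ^ p₁ * a :=
    rpow_one_add_le_of_rpow_one_add_le hp₂ hp ha hab' hb'b hr
      (rpow_one_add_le_of_le_geom_mean hp₂ ha (ha.trans_le hab') hr hrn)
  have hh' : 0 ≤ h - 1 := sub_nonneg.2 hh
  rw [Real.div_rpow hR.le hr.le]
  refine div_le_div_of_nonneg_left (by positivity) (by positivity) ?_
  calc r ^ (h + (h - 1) * p₁) = r * (r ^ (1 + p₁)) ^ (h - 1) := by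
        rw [← Real.rpow_mul hr.le, ← Real.rpow_one_add' hr.le (by nlinarith)]
        ring_nf
    _ ≤ r * (b ^ p₁ * a) ^ (h - 1) := by gcongr
    _ = r * b ^ ((h - 1) * p₁) * a ^ (h - 1) := by
        rw [Real.mul_rpow (by positivity) ha.le, ← Real.rpow_mul hb.le, mul_comm p₁, mul_assoc]
end

section
/- Let h, p₁, p₂, a, b', b, r, R be real numbers with h ≥ 1, 0 ≤ p₁ ≤ p₂, 0 < a ≤ b' ≤ b, b' ≤ R, and 0 < r ≤ (b')^{p₂/(1+p₂)}·a^{1/(1+p₂)}. Then R^{h+(h−1)p₁} / (r · b^{(h−1)p₁} · a^{h−1}) ≤ (R/r)^{h+(h−1)p₂}. -/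
/-- Global measure formula inequality (Case 3, h ≥ 1, p₁ ≤ p₂):
if `0 < a ≤ b' ≤ b`, `b' ≤ R` and `0 < r ≤ (b')^{p₂/(1+p₂)} a^{1/(1+p₂)}`, then
`R^{h+(h-1)p₁} / (r b^{(h-1)p₁} a^{h-1}) ≤ (R/r)^{h+(h-1)p₂}`. -/
theorem zoom_case3_ineq_h_ge_one_p1_le_p2 (h p₁ p₂ a b' b r R : ℝ)
    (hh : 1 ≤ h) (hp₁ : 0 ≤ p₁) (hp : p₁ ≤ p₂)
    (ha : 0 < a) (hab' : a ≤ b') (hb'b : b' ≤ b) (hb'R : b' ≤ R) (hr : 0 < r)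
    (hrn : r ≤ b' ^ (p₂ / (1 + p₂)) * a ^ (1 / (1 + p₂))) :
    R ^ (h + (h - 1) * p₁) / (r * b ^ ((h - 1) * p₁) * a ^ (h - 1))
      ≤ (R / r) ^ (h + (h - 1) * p₂) := by
  have hb' : 0 < b' := ha.trans_le hab'
  have hb : 0 < b := hb'.trans_le hb'b
  have hR : 0 < R := hb'.trans_le hb'R
  have hp₂ : 0 < 1 + p₂ := by linarith
  have hlog_r : (1 + p₂) * Real.log r ≤ p₂ * Real.log b' + Real.log a := by
    have hlog := Real.log_le_log hr hrn
    rw [Real.log_mul (by positivity) (by positivity), Real.log_rpow hb', Real.log_rpow ha] at hlog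
    calc (1 + p₂) * Real.log r
        ≤ (1 + p₂) * (p₂ / (1 + p₂) * Real.log b' + 1 / (1 + p₂) * Real.log a) := by gcongr
      _ = p₂ * Real.log b' + Real.log a := by field_simp
  have hlog_b : p₁ * Real.log b' ≤ p₁ * Real.log b := by gcongr
  have hlog_R : (p₂ - p₁) * Real.log b' ≤ (p₂ - p₁) * Real.log R :=
    mul_le_mul_of_nonneg_left (Real.log_le_log hb' hb'R) (sub_nonneg.2 hp)
  have hkey : (h - 1) * ((1 + p₂) * Real.log r) ≤
      (h - 1) * ((p₂ - p₁) * Real.log R + p₁ * Real.log b + Real.log a) :=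
    mul_le_mul_of_nonneg_left (by linarith) (sub_nonneg.2 hh)
  rw [← Real.log_le_log_iff (by positivity) (by positivity),
    Real.log_div (by positivity) (by positivity), Real.log_mul (by positivity) (by positivity),
    Real.log_mul (by positivity) (by positivity), Real.log_rpow hR, Real.log_rpow hb,
    Real.log_rpow ha, Real.log_rpow (by positivity), Real.log_div hR.ne' hr.ne']
  linarith
end

section
/- Let h, p, θ, r, a, b, B be real numbers with 0 < h ≤ 1, p ≥ 0, 0 < θ < 1, 0 < r < 1, and 0 < a ≤ b ≤ B. Then: (i) (r^θ/r)^{h} · (r^θ/b)^{(h−1)p} ≤ B^{(1−h)p} · (r^θ/r)^{h + (θp/(1−θ))·(1−h)}; and (ii) if moreover r^θ ≤ b^{p/(1+p)}·a^{1/(1+p)}, then (r^θ/r)^{h} · (a/r^θ)^{h−1} ≤ B^{(1−h)p} · (r^θ/r)^{h + (θp/(1−θ))·(1−h)}. -/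
/-- Assouad spectrum upper bound computation (h < 1): for `0 < h ≤ 1`, `p ≥ 0`,
`0 < θ < 1`, `0 < r < 1` and zoom radii `0 < a ≤ b ≤ B`, both
`(r^θ/r)^h (r^θ/b)^{(h-1)p} ≤ B^{(1-h)p} (r^θ/r)^{h+(θp/(1-θ))(1-h)}` and,
when `r^θ ≤ b^{p/(1+p)} a^{1/(1+p)}`,
`(r^θ/r)^h (a/r^θ)^{h-1} ≤ B^{(1-h)p} (r^θ/r)^{h+(θp/(1-θ))(1-h)}`. -/
theorem assouad_spectrum_ineq_h_lt_one (h p θ r a b B : ℝ)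
    (hh0 : 0 < h) (hh : h ≤ 1) (hp : 0 ≤ p) (hθ0 : 0 < θ) (hθ1 : θ < 1)
    (hr0 : 0 < r) (hr1 : r < 1) (ha : 0 < a) (hab : a ≤ b) (hbB : b ≤ B) :
    ((r ^ θ / r) ^ h * (r ^ θ / b) ^ ((h - 1) * p)
        ≤ B ^ ((1 - h) * p) * (r ^ θ / r) ^ (h + θ * p / (1 - θ) * (1 - h)) ∧
      (r ^ θ ≤ b ^ (p / (1 + p)) * a ^ (1 / (1 + p)) →
        (r ^ θ / r) ^ h * (a / r ^ θ) ^ (h - 1)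
          ≤ B ^ ((1 - h) * p) * (r ^ θ / r) ^ (h + θ * p / (1 - θ) * (1 - h)))) := by
  have hb : 0 < b := ha.trans_le hab
  have hB : 0 < B := hb.trans_le hbB
  have hrθ : 0 < r ^ θ := Real.rpow_pos_of_pos hr0 θ
  have hR : 0 < r ^ θ / r := div_pos hrθ hr0
  have hlogR : Real.log (r ^ θ / r) = (θ - 1) * Real.log r := by
    rw [Real.log_div hrθ.ne' hr0.ne', Real.log_rpow hr0]; ring
  have hlogb : Real.log b ≤ Real.log B := Real.log_le_log hb hbB
  have hRHS : Real.log (B ^ ((1 - h) * p) * (r ^ θ / r) ^ (h + θ * p / (1 - θ) * (1 - h))) =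
      h * ((θ - 1) * Real.log r) + (1 - h) * (p * Real.log B - p * θ * Real.log r) := by
    have hθ : 1 - θ ≠ 0 := (sub_pos.2 hθ1).ne'
    rw [Real.log_mul (by positivity) (by positivity), Real.log_rpow hB, Real.log_rpow hR, hlogR]
    field_simp
    ring
  refine ⟨?_, fun hr => ?_⟩
  · rw [← Real.log_le_log_iff (by positivity) (by positivity), hRHS,
      Real.log_mul (by positivity) (by positivity), Real.log_rpow hR, hlogR,
      Real.log_rpow (by positivity), Real.log_div hrθ.ne' hb.ne', Real.log_rpow hr0]
    have := mul_le_mul_of_nonneg_left hlogb (mul_nonneg (sub_nonneg.2 hh) hp)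
    linarith
  · have hp1 : 0 < 1 + p := by linarith
    have hlog := Real.log_le_log hrθ hr
    rw [Real.log_mul (by positivity) (by positivity), Real.log_rpow hr0, Real.log_rpow hb,
      Real.log_rpow ha, div_mul_eq_mul_div, div_mul_eq_mul_div, ← add_div, le_div_iff₀ hp1] at hlog
    rw [← Real.log_le_log_iff (by positivity) (by positivity), hRHS,
      Real.log_mul (by positivity) (by positivity), Real.log_rpow hR, hlogR,
      Real.log_rpow (by positivity), Real.log_div ha.ne' hrθ.ne', Real.log_rpow hr0]
    have hpb := mul_le_mul_of_nonneg_left hlogb hp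
    have key : θ * Real.log r - Real.log a ≤ p * Real.log B - p * θ * Real.log r := by linarith
    have := mul_le_mul_of_nonneg_left key (sub_nonneg.2 hh)
    linarith
end

section
/- Let h, p, θ, r, a, b, B be real numbers with h ≥ 1, p ≥ 0, 0 < θ < 1, 0 < r < 1, and 0 < a ≤ b ≤ B. Then: (i) (r^θ/r)^{h} · (r^θ/b)^{(h−1)p} ≥ B^{(1−h)p} · (r^θ/r)^{h + (θp/(1−θ))·(1−h)}; and (ii) if moreover r^θ ≤ b^{p/(1+p)}·a^{1/(1+p)}, then (r^θ/r)^{h} · (a/r^θ)^{h−1} ≥ B^{(1−h)p} · (r^θ/r)^{h + (θp/(1−θ))·(1−h)}. -/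
/-- Lower spectrum lower bound computation (h ≥ 1): for `h ≥ 1`, `p ≥ 0`,
`0 < θ < 1`, `0 < r < 1` and zoom radii `0 < a ≤ b ≤ B`, both
`(r^θ/r)^h (r^θ/b)^{(h-1)p} ≥ B^{(1-h)p} (r^θ/r)^{h+(θp/(1-θ))(1-h)}` and,
when `r^θ ≤ b^{p/(1+p)} a^{1/(1+p)}`,
`(r^θ/r)^h (a/r^θ)^{h-1} ≥ B^{(1-h)p} (r^θ/r)^{h+(θp/(1-θ))(1-h)}`. -/
theorem lower_spectrum_ineq_h_ge_one (h p θ r a b B : ℝ)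
    (hh : 1 ≤ h) (hp : 0 ≤ p) (hθ0 : 0 < θ) (hθ1 : θ < 1)
    (hr0 : 0 < r) (hr1 : r < 1) (ha : 0 < a) (hab : a ≤ b) (hbB : b ≤ B) :
    (B ^ ((1 - h) * p) * (r ^ θ / r) ^ (h + θ * p / (1 - θ) * (1 - h))
        ≤ (r ^ θ / r) ^ h * (r ^ θ / b) ^ ((h - 1) * p) ∧
      (r ^ θ ≤ b ^ (p / (1 + p)) * a ^ (1 / (1 + p)) →
        B ^ ((1 - h) * p) * (r ^ θ / r) ^ (h + θ * p / (1 - θ) * (1 - h))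
          ≤ (r ^ θ / r) ^ h * (a / r ^ θ) ^ (h - 1))) := by
  have hB : 0 < B := ha.trans_le (hab.trans hbB)
  have hb : 0 < b := ha.trans_le hab
  have ht : 0 < r ^ θ := Real.rpow_pos_of_pos hr0 θ
  have hQ : 0 < r ^ θ / r := div_pos ht hr0
  have hexp : 0 ≤ (h - 1) * p := mul_nonneg (sub_nonneg.2 hh) hp
  have hθ : 1 - θ ≠ 0 := (sub_pos.2 hθ1).ne'
  have hquot : r ^ θ / r = r ^ (θ - 1) := by
    rw [Real.rpow_sub hr0, Real.rpow_one]
  have hcollapse : (r ^ θ / r) ^ (θ * p / (1 - θ) * (1 - h)) = (r ^ θ) ^ ((h - 1) * p) := by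
    rw [hquot, ← Real.rpow_mul hr0.le, ← Real.rpow_mul hr0.le]
    congr 1
    field_simp
    ring
  have hlhs : B ^ ((1 - h) * p) * (r ^ θ / r) ^ (h + θ * p / (1 - θ) * (1 - h))
      = (r ^ θ / r) ^ h * (r ^ θ / B) ^ ((h - 1) * p) := by
    rw [Real.rpow_add hQ, hcollapse, Real.div_rpow ht.le hB.le,
      show (1 - h) * p = -((h - 1) * p) by ring, Real.rpow_neg hB.le]
    ring
  have hfirst : (r ^ θ / r) ^ h * (r ^ θ / B) ^ ((h - 1) * p)
      ≤ (r ^ θ / r) ^ h * (r ^ θ / b) ^ ((h - 1) * p) := by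
    gcongr
  rw [hlhs]
  refine ⟨hfirst, fun htr => hfirst.trans ?_⟩
  have hp1 : 0 < 1 + p := by linarith
  have hpow : (r ^ θ) ^ p * r ^ θ ≤ b ^ p * a := by
    calc (r ^ θ) ^ p * r ^ θ = (r ^ θ) ^ (1 + p) := by
          rw [Real.rpow_add ht, Real.rpow_one, mul_comm]
      _ ≤ (b ^ (p / (1 + p)) * a ^ (1 / (1 + p))) ^ (1 + p) :=
          Real.rpow_le_rpow ht.le htr hp1.le
      _ = b ^ p * a := by
          rw [Real.mul_rpow (by positivity) (by positivity), ← Real.rpow_mul hb.le,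
            ← Real.rpow_mul ha.le, div_mul_cancel₀ _ hp1.ne', div_mul_cancel₀ _ hp1.ne',
            Real.rpow_one]
  have hbase : (r ^ θ / b) ^ p ≤ a / r ^ θ := by
    rw [Real.div_rpow ht.le hb.le, div_le_div_iff₀ (Real.rpow_pos_of_pos hb p) ht]
    linarith
  rw [mul_comm (h - 1) p, Real.rpow_mul (div_pos ht hb).le]
  exact mul_le_mul_of_nonneg_left
    (Real.rpow_le_rpow (by positivity) hbase (sub_nonneg.2 hh)) (by positivity)
end
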